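/- arXiv:2411.19676 — 2 statements merged into one kernel-verified Lean document; each statement's English description precedes it below -/
import Mathlib

section
/- (Adams-type pointwise estimate.) Let n ≥ 2, m ≥ 1, 0 < α < mn, 1 < s ≤ ∞, and let Ω⃗ = (Ω_1,…,Ω_m) ∈ L^s(S^{n−1}). Let s' ≤ p_1,…,p_m < ∞, let 1/p = 1/p_1 + ⋯ + 1/p_m with s'/m ≤ p < n/α, let 0 < κ < 1 − αp/n, and define q by 1/q = 1/p − α/(n(1−κ)). Then there exists a constant C > 0, independent of f⃗, such that for all measurable f_i with ‖f_i‖_{L^{p_i,κ}} < ∞ (i = 1,…,m) and every x ∈ ℝⁿ, |T_{Ω,α;m}(f⃗)(x)| ≤ C [M_{s'}(f⃗)(x)]^{p/q} · (∏_{i=1}^m ‖f_i‖_{L^{p_i,κ}})^{1−p/q}. -/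
open MeasureTheory Metric ENNReal

noncomputable section

/-- Euclidean space `ℝⁿ`. -/
abbrev Euc (n : ℕ) := EuclideanSpace ℝ (Fin n)

/-- `Ω` is homogeneous of degree zero. -/
def HomogZero {n : ℕ} (Ω : Euc n → ℝ) : Prop :=
  ∀ ⦃l : ℝ⦄, 0 < l → ∀ x, Ω (l • x) = Ω x

/-- The `L^s` norm of `Ω` on the unit sphere `S^{n-1}`, where the surface measure
`volume.toSphere` is normalized so that the polar coordinate formula
`∫_{ℝⁿ} g(y) dy = ∫_0^∞ ∫_{S^{n-1}} g(ρθ) ρ^{n-1} dσ(θ) dρ` holds. -/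
noncomputable def sphereLpNorm (n : ℕ) (s : ℝ≥0∞) (Ω : Euc n → ℝ) : ℝ≥0∞ :=
  eLpNorm (fun θ : sphere (0 : Euc n) 1 => Ω θ.1) s ((volume : Measure (Euc n)).toSphere)

/-- `Ω ∈ L^s(S^{n-1})`: measurable, homogeneous of degree zero, finite sphere `L^s` norm. -/
def MemSphereLp (n : ℕ) (s : ℝ≥0∞) (Ω : Euc n → ℝ) : Prop :=
  Measurable Ω ∧ HomogZero Ω ∧ sphereLpNorm n s Ω < ⊤

/-- The conjugate exponent `s' = s/(s-1)` (with `s' = 1` for `s = ∞`). -/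
noncomputable def conjExp (s : ℝ≥0∞) : ℝ := if s = ⊤ then 1 else s.toReal / (s.toReal - 1)

/-- The multilinear fractional integral operator with homogeneous kernels,
`T_{Ω,α;m}(f⃗)(x) = ∫_{(ℝⁿ)^m} ∏ᵢ Ωᵢ(x-yᵢ) fᵢ(yᵢ) / ‖(x-y₁,…,x-y_m)‖^{mn-α} dy⃗`. -/
noncomputable def multiT {n : ℕ} (m : ℕ) (α : ℝ) (Ω f : Fin m → Euc n → ℝ) (x : Euc n) : ℝ :=
  ∫ y : Fin m → Euc n,
    (∏ i, Ω i (x - y i) * f i (y i)) /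
      (Real.sqrt (∑ j, ‖x - y j‖ ^ 2)) ^ ((m * n : ℝ) - α)

/-- The multilinear maximal operator `𝓜(f⃗)(x)`, with values in `[0,∞]`. -/
noncomputable def multiM {n : ℕ} (m : ℕ) (f : Fin m → Euc n → ℝ) (x : Euc n) : ℝ≥0∞ :=
  ⨆ r : Set.Ioi (0 : ℝ),
    ∏ i, (volume (ball x (r : ℝ)))⁻¹ * ∫⁻ y in ball x (r : ℝ), ENNReal.ofReal |f i y|

/-- `𝓜_t(f⃗)(x) = 𝓜(|f₁|^t,…,|f_m|^t)(x)^{1/t}`, with values in `[0,∞]`. -/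
noncomputable def multiMt {n : ℕ} (m : ℕ) (t : ℝ) (f : Fin m → Euc n → ℝ) (x : Euc n) : ℝ≥0∞ :=
  (multiM m (fun i y => |f i y| ^ t) x) ^ (1 / t)

/-- The multilinear fractional maximal operator with homogeneous kernels,
`M_{Ω,α;m}(f⃗)(x) = sup_{r>0} ∏ᵢ m(B(x,r))^{α/(mn)-1} ∫_{|x-yᵢ|<r} |Ωᵢ(x-yᵢ) fᵢ(yᵢ)| dyᵢ`,
with values in `[0,∞]`. -/
noncomputable def multiMF {n : ℕ} (m : ℕ) (α : ℝ) (Ω f : Fin m → Euc n → ℝ) (x : Euc n) :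
    ℝ≥0∞ :=
  ⨆ r : Set.Ioi (0 : ℝ),
    ∏ i, (volume (ball x (r : ℝ))) ^ (α / (m * n : ℝ) - 1) *
      ∫⁻ y in ball x (r : ℝ), ENNReal.ofReal |Ω i (x - y) * f i y|

/-- Morrey norm of a `[0,∞]`-valued function:
`sup_B (m(B)^{-κ} ∫_B F^p)^{1/p}`, the supremum over all balls `B ⊆ ℝⁿ`. -/
noncomputable def morreyNormE {n : ℕ} (p κ : ℝ) (F : Euc n → ℝ≥0∞) : ℝ≥0∞ :=
  ⨆ (z : Euc n) (r : Set.Ioi (0 : ℝ)),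
    (volume (ball z (r : ℝ)) ^ (-κ) * ∫⁻ y in ball z (r : ℝ), F y ^ p) ^ (1 / p)

/-- Morrey norm `‖f‖_{L^{p,κ}}`. -/
noncomputable def morreyNorm {n : ℕ} (p κ : ℝ) (f : Euc n → ℝ) : ℝ≥0∞ :=
  morreyNormE p κ (fun x => ENNReal.ofReal |f x|)

/-- Weak Morrey norm of a `[0,∞]`-valued function:
`sup_B sup_{l>0} m(B)^{-κ/p} · l · m({y ∈ B : F y > l})^{1/p}`. -/
noncomputable def weakMorreyNormE {n : ℕ} (p κ : ℝ) (F : Euc n → ℝ≥0∞) : ℝ≥0∞ :=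
  ⨆ (z : Euc n) (r : Set.Ioi (0 : ℝ)) (l : Set.Ioi (0 : ℝ)),
    volume (ball z (r : ℝ)) ^ (-(κ / p)) * ENNReal.ofReal (l : ℝ) *
      (volume {y | y ∈ ball z (r : ℝ) ∧ ENNReal.ofReal (l : ℝ) < F y}) ^ (1 / p)

/-- Weak Morrey norm `‖f‖_{WL^{p,κ}}`. -/
noncomputable def weakMorreyNorm {n : ℕ} (p κ : ℝ) (f : Euc n → ℝ) : ℝ≥0∞ :=
  weakMorreyNormE p κ (fun x => ENNReal.ofReal |f x|)

/-- Luxemburg norm `‖f‖_{L^p log L(B)}`. -/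
noncomputable def luxNorm {n : ℕ} (p : ℝ) (B : Set (Euc n)) (f : Euc n → ℝ) : ℝ :=
  sInf {l : ℝ | 0 < l ∧
    ∫⁻ x in B, ENNReal.ofReal ((|f x| / l) ^ p * (1 + max (Real.log (|f x| / l)) 0)) ≤ 1}

/-- `‖f‖_{(L log L)^{p,κ}} = sup_B m(B)^{-κ/p} ‖f‖_{L^p log L(B)}`. -/
noncomputable def logMorreyNorm {n : ℕ} (p κ : ℝ) (f : Euc n → ℝ) : ℝ≥0∞ :=
  ⨆ (z : Euc n) (r : Set.Ioi (0 : ℝ)),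
    volume (ball z (r : ℝ)) ^ (-(κ / p)) *
      ENNReal.ofReal (luxNorm p (ball z (r : ℝ)) f)

/-- Weak `L^p` norm `‖f‖_{L^{p,∞}} = sup_{l>0} l · m({|f| > l})^{1/p}`. -/
noncomputable def weakLpNorm {n : ℕ} (p : ℝ) (f : Euc n → ℝ) : ℝ≥0∞ :=
  ⨆ l : Set.Ioi (0 : ℝ),
    ENNReal.ofReal (l : ℝ) * (volume {x | (l : ℝ) < |f x|}) ^ (1 / p)

/-- **Tonelli's theorem** for a product of functions of one variable each. -/
theorem lintegral_pi_prod_eq_prod {E : Type*} [MeasurableSpace E] (μ : Measure E) [SigmaFinite μ]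
    {m : ℕ} (g : Fin m → E → ℝ≥0∞) (hg : ∀ i, Measurable (g i)) :
    ∫⁻ y : Fin m → E, ∏ i, g i (y i) ∂(Measure.pi fun _ => μ) = ∏ i, ∫⁻ y, g i y ∂μ := by
  induction m with
  | zero => simp
  | succ m ih =>
    have hmeas : Measurable fun y : Fin (m + 1) → E => ∏ i, g i (y i) :=
      Finset.measurable_fun_prod _ fun i _ => (hg i).comp (measurable_pi_apply i)
    have hmeas' : Measurable fun y : Fin m → E => ∏ i, g (Fin.succ i) (y i) :=
      Finset.measurable_fun_prod _ fun i _ => (hg _).comp (measurable_pi_apply i)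
    have h := ((measurePreserving_piFinSuccAbove (fun _ : Fin (m + 1) => μ) 0).symm).lintegral_comp
      hmeas
    rw [← h, Fin.prod_univ_succ, ← ih _ fun i => hg _,
      ← lintegral_prod_mul (hg 0).aemeasurable hmeas'.aemeasurable]
    refine lintegral_congr fun z => ?_
    simp [MeasurableEquiv.piFinSuccAbove_symm_apply, Fin.insertNthEquiv, Fin.prod_univ_succ]

theorem one_le_conjExp {s : ℝ≥0∞} (hs : 1 < s) : 1 ≤ conjExp s := by
  unfold conjExp
  split_ifs with h
  · exact le_rfl
  · have : 1 < s.toReal := by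
      rw [← ENNReal.toReal_one]; exact (ENNReal.toReal_lt_toReal (by simp) h).2 hs
    rw [le_div_iff₀ (by linarith)]
    linarith

theorem one_div_add_one_div_conjExp {s : ℝ≥0∞} (hs : 1 < s) :
    1 / s.toReal + 1 / conjExp s = 1 := by
  unfold conjExp
  split_ifs with h
  · simp [h]
  · have : 1 < s.toReal := by
      rw [← ENNReal.toReal_one]; exact (ENNReal.toReal_lt_toReal (by simp) h).2 hs
    have h1 : s.toReal - 1 ≠ 0 := by linarith
    have h2 : s.toReal ≠ 0 := by linarith
    field_simp
    ring

theorem holderConjugate_conjExp {s : ℝ≥0∞} (hs : 1 < s) :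
    ENNReal.HolderConjugate s (ENNReal.ofReal (conjExp s)) := by
  rw [ENNReal.holderConjugate_iff]
  have h1 := one_le_conjExp hs
  have h2 := one_div_add_one_div_conjExp hs
  have hs0 : s⁻¹ ≠ ⊤ := by simpa using (zero_lt_one.trans hs).ne'
  rw [← ENNReal.ofReal_inv_of_pos (by linarith), ← ENNReal.ofReal_toReal hs0,
    ← ENNReal.ofReal_add (by positivity) (by positivity), ENNReal.toReal_inv]
  simpa using congrArg ENNReal.ofReal h2

theorem eLpNorm_ball_eq_sphereLpNorm {n : ℕ} (hn : 0 < n) {s : ℝ≥0∞} {Ω : Euc n → ℝ}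
    (hm : Measurable Ω) (hΩ : HomogZero Ω) {R : ℝ} (hR : 0 < R) :
    eLpNorm Ω s (volume.restrict (ball 0 R)) =
      ENNReal.ofReal (R ^ n / n) ^ (1 / s.toReal) * sphereLpNorm n s Ω := by
  have : Nonempty (Fin n) := ⟨⟨0, hn⟩⟩
  have : Nontrivial (Euc n) := inferInstance
  let E := Euc n
  have hc : MeasurableSet ({0}ᶜ : Set E) := (measurableSet_singleton _).compl
  let ν : Measure (Set.Ioi (0 : ℝ)) :=
    (Measure.volumeIoiPow (Module.finrank ℝ E - 1)).restrict (Set.Iio ⟨R, hR⟩)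
  have hν : ν Set.univ = ENNReal.ofReal (R ^ n / n) := by
    simp only [ν, Measure.restrict_apply_univ, Measure.volumeIoiPow_apply_Iio]
    have : Module.finrank ℝ E = n := by simp [E]
    rw [this, Nat.sub_add_cancel hn]
    congr 2
    exact_mod_cast Nat.sub_add_cancel hn
  have hν0 : ν Set.univ ≠ 0 := by
    rw [hν, ENNReal.ofReal_ne_zero_iff]; positivity
  have hmp := (volume : Measure E).measurePreserving_homeomorphUnitSphereProd
  have hmp' := hmp.restrict_preimage_emb (Homeomorph.measurableEmbedding _)
    (Set.univ ×ˢ Set.Iio (⟨R, hR⟩ : Set.Ioi (0 : ℝ)))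
  have hpre : homeomorphUnitSphereProd E ⁻¹' (Set.univ ×ˢ Set.Iio (⟨R, hR⟩ : Set.Ioi (0 : ℝ)))
      = (Subtype.val : ({0}ᶜ : Set E) → E) ⁻¹' ball 0 R := by
    ext z
    simp [← Subtype.coe_lt_coe]
  rw [hpre, ← Measure.prod_restrict, Measure.restrict_univ] at hmp'
  have hΩs : Measurable fun θ : sphere (0 : E) 1 => Ω θ.1 := hm.comp measurable_subtype_coe
  have h1 : eLpNorm Ω s (volume.restrict (ball 0 R)) =
      eLpNorm (fun z : ({0}ᶜ : Set E) => Ω z)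
        s ((Measure.comap Subtype.val volume).restrict (Subtype.val ⁻¹' ball 0 R)) := by
    have := (MeasurableEmbedding.subtype_coe hc).eLpNorm_map_measure (g := Ω) (p := s)
      (μ := (Measure.comap Subtype.val volume).restrict (Subtype.val ⁻¹' ball (0 : E) R))
    rw [← (MeasurableEmbedding.subtype_coe hc).restrict_map,
      (MeasurableEmbedding.subtype_coe hc).map_comap, Subtype.range_coe,
      restrict_compl_singleton] at this
    exact this
  have h2 : (fun z : ({0}ᶜ : Set E) => Ω z) =
      ((fun θ : sphere (0 : E) 1 => Ω θ.1) ∘ Prod.fst) ∘ homeomorphUnitSphereProd E := by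
    ext z
    have hz : (0 : ℝ) < ‖(z : E)‖⁻¹ := inv_pos.2 (norm_pos_iff.2 z.2)
    simp [hΩ hz]
  rw [h1, h2, eLpNorm_comp_measurePreserving
    (hΩs.comp measurable_fst).aestronglyMeasurable hmp',
    ← eLpNorm_map_measure hΩs.aestronglyMeasurable measurable_fst.aemeasurable,
    Measure.map_fst_prod, eLpNorm_smul_measure_of_ne_zero hν0, hν]
  simp [sphereLpNorm]

theorem MemSphereLp.exists_eLpNorm_ball_le {n : ℕ} (hn : 0 < n) {s : ℝ≥0∞} {Ω : Euc n → ℝ}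
    (hΩ : MemSphereLp n s Ω) :
    ∃ K : ℝ≥0∞, K ≠ ⊤ ∧ ∀ (x : Euc n) (R : ℝ), 0 < R →
      eLpNorm (fun y => Ω (x - y)) s (volume.restrict (ball x R)) ≤
        K * volume (ball x R) ^ (1 / s.toReal) := by
  have : Nonempty (Fin n) := ⟨⟨0, hn⟩⟩
  have : Nontrivial (Euc n) := inferInstance
  have hv0 : volume (ball (0 : Euc n) 1) ≠ 0 := (measure_ball_pos _ _ one_pos).ne'
  have hvt : volume (ball (0 : Euc n) 1) ≠ ⊤ := measure_ball_lt_top.ne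
  have hs : 0 ≤ 1 / s.toReal := by positivity
  refine ⟨((volume (ball (0 : Euc n) 1))⁻¹) ^ (1 / s.toReal) * sphereLpNorm n s Ω,
    ENNReal.mul_ne_top (ENNReal.rpow_ne_top_of_nonneg hs (by simpa using hv0)) hΩ.2.2.ne,
    fun x R hR => ?_⟩
  have hmp : MeasurePreserving (fun y : Euc n => x - y) (volume.restrict (ball x R))
      (volume.restrict (ball 0 R)) := by
    have := ((Measure.measurePreserving_sub_left (volume : Measure (Euc n)) x)).restrict_preimage
      (s := ball 0 R) measurableSet_ball
    convert this using 2
    ext y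
    simp [dist_eq_norm, norm_sub_rev]
  have h := eLpNorm_comp_measurePreserving (p := s) hΩ.1.aestronglyMeasurable hmp
  have h' : Ω ∘ (fun y => x - y) = fun y => Ω (x - y) := rfl
  rw [h'] at h
  rw [h, eLpNorm_ball_eq_sphereLpNorm hn hΩ.1 hΩ.2.1 hR, mul_right_comm,
    ← ENNReal.mul_rpow_of_nonneg _ _ hs]
  gcongr
  rw [Measure.addHaar_ball_of_pos _ _ hR, mul_left_comm, ENNReal.inv_mul_cancel hv0 hvt, mul_one]
  apply ENNReal.ofReal_le_ofReal
  simp only [finrank_euclideanSpace, Fintype.card_fin]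
  exact div_le_self (by positivity) (by exact_mod_cast hn)

theorem lintegral_Ioc_ofReal_rpow {a r : ℝ} (ha : 0 < a) (hr : 0 < r) :
    ∫⁻ R in Set.Ioc 0 r, ENNReal.ofReal (R ^ (a - 1)) = ENNReal.ofReal (r ^ a / a) := by
  have hi : IntervalIntegrable (fun R : ℝ => R ^ (a - 1)) volume 0 r :=
    intervalIntegral.intervalIntegrable_rpow' (by linarith)
  rw [← ofReal_integral_eq_lintegral_ofReal
    ((intervalIntegrable_iff_integrableOn_Ioc_of_le hr.le).1 hi)
    ((ae_restrict_iff' measurableSet_Ioc).2 (.of_forall fun R hR => Real.rpow_nonneg hR.1.le _)),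
    ← intervalIntegral.integral_of_le hr.le, integral_rpow (Or.inl (by linarith))]
  simp [Real.zero_rpow ha.ne']

theorem lintegral_Ioi_ofReal_rpow {a r : ℝ} (ha : 0 < a) (hr : 0 < r) :
    ∫⁻ R in Set.Ioi r, ENNReal.ofReal (R ^ (-a - 1)) = ENNReal.ofReal (r ^ (-a) / a) := by
  rw [← ofReal_integral_eq_lintegral_ofReal
    (integrableOn_Ioi_rpow_of_lt (by linarith) hr)
    ((ae_restrict_iff' measurableSet_Ioi).2
      (.of_forall fun R hR => Real.rpow_nonneg (hr.le.trans (le_of_lt hR)) _)),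
    integral_Ioi_rpow_of_lt (by linarith) hr]
  congr 1
  rw [sub_add_cancel, div_neg, neg_div, neg_neg]

/-- Optimization of the splitting radius: a function on `(0, ∞)` bounded by both `R ^ (α - 1) M`
and `R ^ (α - β - 1) A` has integral at most a multiple of `M ^ (1 - α / β) A ^ (α / β)`. -/
theorem lintegral_Ioi_le_of_le_rpow {α β : ℝ} (hα : 0 < α) (hαβ : α < β) {K M A : ℝ≥0∞}
    (hK : K ≠ ⊤) (hA : A ≠ ⊤) {H : ℝ → ℝ≥0∞}
    (hM : ∀ R, 0 < R → H R ≤ K * ENNReal.ofReal (R ^ (α - 1)) * M)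
    (hHA : ∀ R, 0 < R → H R ≤ K * ENNReal.ofReal (R ^ (-(β - α) - 1)) * A) :
    ∫⁻ R in Set.Ioi 0, H R ≤
      (1 + K * ENNReal.ofReal (1 / α + 1 / (β - α))) * M ^ (1 - α / β) * A ^ (α / β) := by
  have hβ : 0 < β := hα.trans hαβ
  have hβα : 0 < β - α := sub_pos.2 hαβ
  have hθ0 : 0 < α / β := by positivity
  have hθ1 : 0 < 1 - α / β := by rw [sub_pos, div_lt_one hβ]; exact hαβ
  have hzero : (∀ R, 0 < R → H R = 0) → ∫⁻ R in Set.Ioi 0, H R = 0 := fun h => by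
    rw [setLIntegral_congr_fun measurableSet_Ioi (g := fun _ => 0) fun R hR => h R hR]
    simp
  rcases eq_or_ne A 0 with rfl | hA0
  · rw [hzero fun R hR => by simpa using hHA R hR]; exact zero_le
  rcases eq_or_ne M 0 with rfl | hM0
  · rw [hzero fun R hR => by simpa using hM R hR]; exact zero_le
  rcases eq_or_ne M ⊤ with rfl | hMt
  · rw [ENNReal.top_rpow_of_pos hθ1, ENNReal.mul_top (by simp), ENNReal.top_mul]
    · exact le_top
    · exact (ENNReal.rpow_pos (pos_iff_ne_zero.2 hA0) hA).ne'
  lift A to NNReal using hA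
  lift M to NNReal using hMt
  have hA' : 0 < (A : ℝ) := by exact_mod_cast pos_iff_ne_zero.2 hA0
  have hM' : 0 < (M : ℝ) := by exact_mod_cast pos_iff_ne_zero.2 hM0
  set r : ℝ := ((A : ℝ) / M) ^ (1 / β) with hrdef
  have hr : 0 < r := by positivity
  have e1 : r ^ α * (M : ℝ) = (M : ℝ) ^ (1 - α / β) * (A : ℝ) ^ (α / β) := by
    rw [hrdef, ← Real.rpow_mul (by positivity), Real.div_rpow (by positivity) (by positivity),
      Real.rpow_sub hM', Real.rpow_one, one_div_mul_eq_div]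
    ring
  have e2 : r ^ (-(β - α)) * (A : ℝ) = (M : ℝ) ^ (1 - α / β) * (A : ℝ) ^ (α / β) := by
    rw [← e1, neg_sub, Real.rpow_sub hr]
    have : r ^ β = (A : ℝ) / M := by
      rw [hrdef, ← Real.rpow_mul (by positivity), one_div_mul_cancel hβ.ne', Real.rpow_one]
    rw [this]
    field_simp
  have hQ : ((M : ℝ≥0∞) ^ (1 - α / β) * (A : ℝ≥0∞) ^ (α / β)) =
      ENNReal.ofReal ((M : ℝ) ^ (1 - α / β) * (A : ℝ) ^ (α / β)) := by
    rw [ENNReal.ofReal_mul (by positivity), ← ENNReal.ofReal_rpow_of_pos hM',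
      ← ENNReal.ofReal_rpow_of_pos hA', ENNReal.ofReal_coe_nnreal, ENNReal.ofReal_coe_nnreal]
  rw [← Set.Ioc_union_Ioi_eq_Ioi hr.le]
  refine (lintegral_union_le _ _ _).trans ?_
  have b1 : ∫⁻ R in Set.Ioc 0 r, H R ≤ K * ENNReal.ofReal (r ^ α / α) * M := by
    rw [← lintegral_Ioc_ofReal_rpow hα hr, ← lintegral_const_mul' _ _ hK,
      ← lintegral_mul_const' _ _ ENNReal.coe_ne_top]
    exact setLIntegral_mono' measurableSet_Ioc fun R hR => hM R hR.1
  have b2 : ∫⁻ R in Set.Ioi r, H R ≤ K * ENNReal.ofReal (r ^ (-(β - α)) / (β - α)) * A := by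
    rw [← lintegral_Ioi_ofReal_rpow hβα hr, ← lintegral_const_mul' _ _ hK,
      ← lintegral_mul_const' _ _ ENNReal.coe_ne_top]
    exact setLIntegral_mono' measurableSet_Ioi fun R hR => hHA R (hr.trans hR)
  refine (add_le_add b1 b2).trans ?_
  have c1 : ENNReal.ofReal (r ^ α / α) * M =
      ENNReal.ofReal (1 / α) * ((M : ℝ≥0∞) ^ (1 - α / β) * (A : ℝ≥0∞) ^ (α / β)) := by
    rw [hQ, ← e1, ← ENNReal.ofReal_coe_nnreal, ← ENNReal.ofReal_mul (by positivity),
      ← ENNReal.ofReal_mul (by positivity)]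
    congr 1; ring
  have c2 : ENNReal.ofReal (r ^ (-(β - α)) / (β - α)) * A =
      ENNReal.ofReal (1 / (β - α)) * ((M : ℝ≥0∞) ^ (1 - α / β) * (A : ℝ≥0∞) ^ (α / β)) := by
    rw [hQ, ← e2, ← ENNReal.ofReal_coe_nnreal, ← ENNReal.ofReal_mul (by positivity),
      ← ENNReal.ofReal_mul (by positivity)]
    congr 1; ring
  rw [mul_assoc, mul_assoc, c1, c2, ← mul_add, ← add_mul,
    ← ENNReal.ofReal_add (by positivity) (by positivity), ← mul_assoc, mul_assoc (1 + _)]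
  gcongr
  exact le_add_self

theorem ofReal_abs_multiT_le {n m : ℕ} {α : ℝ} (hα : α < m * n) {Ω f : Fin m → Euc n → ℝ}
    (hΩ : ∀ i, Measurable (Ω i)) (hf : ∀ i, Measurable (f i)) (x : Euc n) :
    ENNReal.ofReal |multiT m α Ω f x| ≤
      ENNReal.ofReal (m * n - α) * ∫⁻ R in Set.Ioi (0 : ℝ),
        ENNReal.ofReal (R ^ (-(m * n - α) - 1)) *
          ∏ i, ∫⁻ y in ball x R, ‖Ω i (x - y) * f i y‖ₑ := by
  set γ : ℝ := m * n - α with hγdef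
  have hγ : 0 < γ := sub_pos.2 hα
  let g : Fin m → Euc n → ℝ≥0∞ := fun i y => ‖Ω i (x - y) * f i y‖ₑ
  have hg : ∀ i, Measurable (g i) := fun i =>
    (((hΩ i).comp (measurable_const.sub measurable_id)).mul (hf i)).enorm
  let ρ : (Fin m → Euc n) → ℝ := fun y => Real.sqrt (∑ j, ‖x - y j‖ ^ 2)
  have hρ : ∀ y i, dist (y i) x ≤ ρ y := fun y i => by
    rw [dist_comm, dist_eq_norm]
    refine Real.le_sqrt_of_sq_le ?_
    exact Finset.single_le_sum (f := fun j => ‖x - y j‖ ^ 2) (fun j _ => by positivity)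
      (Finset.mem_univ i)
  let F : (Fin m → Euc n) → ℝ → ℝ≥0∞ := fun y R =>
    ENNReal.ofReal (R ^ (-γ - 1)) * ∏ i, (ball x R).indicator (g i) (y i)
  have hF : Measurable (Function.uncurry F) := by
    refine Measurable.mul (by fun_prop) (Finset.measurable_fun_prod _ fun i _ => ?_)
    have hS : MeasurableSet {z : (Fin m → Euc n) × ℝ | dist (z.1 i) x < z.2} :=
      measurableSet_lt (by fun_prop) measurable_snd
    have hgi : Measurable fun z : (Fin m → Euc n) × ℝ => g i (z.1 i) :=
      (hg i).comp ((measurable_pi_apply i).comp measurable_fst)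
    exact hgi.indicator hS
  have key : ∀ y, ‖(∏ i, Ω i (x - y i) * f i (y i)) / ρ y ^ γ‖ₑ ≤
      ENNReal.ofReal γ * ∫⁻ R in Set.Ioi (0 : ℝ), F y R := fun y => by
    have hρ0 : 0 ≤ ρ y := Real.sqrt_nonneg _
    rcases hρ0.eq_or_lt with h0 | h0
    · simp [← h0, Real.zero_rpow hγ.ne']
    · have hW : ‖(∏ i, Ω i (x - y i) * f i (y i)) / ρ y ^ γ‖ₑ =
          ENNReal.ofReal (ρ y ^ (-γ)) * ∏ i, g i (y i) := by
        rw [div_eq_mul_inv, ← Real.rpow_neg hρ0, enorm_mul, mul_comm,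
          Real.enorm_of_nonneg (Real.rpow_nonneg hρ0 _)]
        congr 1
        simp only [g, ← ofReal_norm, norm_prod]
        exact ENNReal.ofReal_prod_of_nonneg fun i _ => norm_nonneg _
      have hI : ∫⁻ R in Set.Ioi (ρ y), F y R =
          ENNReal.ofReal (ρ y ^ (-γ) / γ) * ∏ i, g i (y i) := by
        rw [← lintegral_Ioi_ofReal_rpow hγ h0, ← lintegral_mul_const _ (by fun_prop)]
        refine setLIntegral_congr_fun measurableSet_Ioi fun R hR => ?_
        simp only [F]
        congr 1
        refine Finset.prod_congr rfl fun i _ => Set.indicator_of_mem ?_ _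
        exact (hρ y i).trans_lt hR
      calc _ = ENNReal.ofReal γ * ∫⁻ R in Set.Ioi (ρ y), F y R := by
            rw [hW, hI, ← mul_assoc, ← ENNReal.ofReal_mul hγ.le, mul_div_cancel₀ _ hγ.ne']
        _ ≤ _ := by
            gcongr
  calc ENNReal.ofReal |multiT m α Ω f x|
      = ‖multiT m α Ω f x‖ₑ := by rw [← Real.norm_eq_abs, ofReal_norm]
    _ ≤ ∫⁻ y : Fin m → Euc n, ‖(∏ i, Ω i (x - y i) * f i (y i)) / ρ y ^ γ‖ₑ :=
      enorm_integral_le_lintegral_enorm _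
    _ ≤ ∫⁻ y : Fin m → Euc n, ENNReal.ofReal γ * ∫⁻ R in Set.Ioi (0 : ℝ), F y R :=
      lintegral_mono key
    _ = ENNReal.ofReal γ * ∫⁻ R in Set.Ioi (0 : ℝ), ∫⁻ y : Fin m → Euc n, F y R := by
      rw [lintegral_const_mul' _ _ ENNReal.ofReal_ne_top,
        lintegral_lintegral_swap hF.aemeasurable]
    _ = _ := by
      congr 1
      refine lintegral_congr fun R => ?_
      rw [lintegral_const_mul' _ _ ENNReal.ofReal_ne_top, volume_pi,
        lintegral_pi_prod_eq_prod _ _ fun i => (hg i).indicator measurableSet_ball]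
      simp only [lintegral_indicator measurableSet_ball, g]

theorem prod_eLpNorm_ball_le_multiMt {n m : ℕ} {t : ℝ} (ht : 0 < t)
    (f : Fin m → Euc n → ℝ) (x : Euc n) {R : ℝ} (hR : 0 < R) :
    ∏ i, eLpNorm (f i) (ENNReal.ofReal t) (volume.restrict (ball x R)) ≤
      volume (ball x R) ^ (m / t) * multiMt m t f x := by
  have hV0 : volume (ball x R) ≠ 0 := (measure_ball_pos _ _ hR).ne'
  have hVt : volume (ball x R) ≠ ⊤ := measure_ball_lt_top.ne
  have ht' : 0 ≤ 1 / t := by positivity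
  have hN : ∀ i, eLpNorm (f i) (ENNReal.ofReal t) (volume.restrict (ball x R)) =
      (volume (ball x R) * ((volume (ball x R))⁻¹ *
        ∫⁻ y in ball x R, ENNReal.ofReal |(|f i y| ^ t)|)) ^ (1 / t) := fun i => by
    rw [eLpNorm_eq_lintegral_rpow_enorm_toReal (by simpa using ht) ENNReal.ofReal_ne_top,
      ENNReal.toReal_ofReal ht.le, ← mul_assoc, ENNReal.mul_inv_cancel hV0 hVt, one_mul]
    congr 1
    refine lintegral_congr fun y => ?_
    rw [abs_of_nonneg (by positivity), ← ENNReal.ofReal_rpow_of_nonneg (abs_nonneg _) ht.le,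
      ← Real.norm_eq_abs, ofReal_norm]
  simp_rw [hN]
  rw [ENNReal.prod_rpow_of_nonneg ht', Finset.prod_mul_distrib, Finset.prod_const,
    Finset.card_univ, Fintype.card_fin, ENNReal.mul_rpow_of_nonneg _ _ ht', multiMt,
    ← ENNReal.rpow_natCast, ← ENNReal.rpow_mul, mul_one_div]
  gcongr
  exact le_iSup (fun r : Set.Ioi (0 : ℝ) => ∏ i, (volume (ball x (r : ℝ)))⁻¹ *
    ∫⁻ y in ball x (r : ℝ), ENNReal.ofReal |(|f i y| ^ t)|) ⟨R, hR⟩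

theorem eLpNorm_ball_le_morreyNorm {n : ℕ} {t p κ : ℝ} (ht : 0 < t) (htp : t ≤ p)
    {f : Euc n → ℝ} (hf : Measurable f) (x : Euc n) {R : ℝ} (hR : 0 < R) :
    eLpNorm f (ENNReal.ofReal t) (volume.restrict (ball x R)) ≤
      volume (ball x R) ^ ((κ - 1) / p + 1 / t) * morreyNorm p κ f := by
  have hV0 : volume (ball x R) ≠ 0 := (measure_ball_pos _ _ hR).ne'
  have hVt : volume (ball x R) ≠ ⊤ := measure_ball_lt_top.ne
  have hp : 0 < p := ht.trans_le htp
  have hp' : 0 ≤ 1 / p := by positivity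
  have h1 : eLpNorm f (ENNReal.ofReal p) (volume.restrict (ball x R)) ≤
      volume (ball x R) ^ (κ / p) * morreyNorm p κ f := by
    have h := le_iSup₂ (f := fun (z : Euc n) (r : Set.Ioi (0 : ℝ)) =>
      (volume (ball z (r : ℝ)) ^ (-κ) *
        ∫⁻ y in ball z (r : ℝ), ENNReal.ofReal |f y| ^ p) ^ (1 / p)) x ⟨R, hR⟩
    rw [eLpNorm_eq_lintegral_rpow_enorm_toReal (by simpa using hp) ENNReal.ofReal_ne_top,
      ENNReal.toReal_ofReal hp.le]
    calc _ = volume (ball x R) ^ (κ / p) * (volume (ball x R) ^ (-κ) *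
          ∫⁻ y in ball x R, ENNReal.ofReal |f y| ^ p) ^ (1 / p) := by
          rw [← mul_one_div κ p, ENNReal.rpow_mul, ← ENNReal.mul_rpow_of_nonneg _ _ hp',
            ← mul_assoc, ← ENNReal.rpow_add _ _ hV0 hVt, add_neg_cancel, ENNReal.rpow_zero,
            one_mul]
          simp only [← Real.norm_eq_abs, ofReal_norm]
      _ ≤ _ := by
          gcongr
          exact h
  refine (eLpNorm_le_eLpNorm_mul_rpow_measure_univ (ENNReal.ofReal_le_ofReal htp)
    hf.aestronglyMeasurable).trans ?_
  rw [Measure.restrict_apply_univ, ENNReal.toReal_ofReal ht.le, ENNReal.toReal_ofReal hp.le]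
  calc _ ≤ volume (ball x R) ^ (κ / p) * morreyNorm p κ f *
        volume (ball x R) ^ (1 / t - 1 / p) := by gcongr
    _ = _ := by
      rw [mul_right_comm, ← ENNReal.rpow_add _ _ hV0 hVt]
      congr 2
      ring

theorem lintegral_ball_enorm_mul_le {n : ℕ} {s : ℝ≥0∞} (hs : 1 < s) {Ω f : Euc n → ℝ}
    (hΩ : Measurable Ω) (hf : Measurable f) (x : Euc n) (R : ℝ) :
    ∫⁻ y in ball x R, ‖Ω (x - y) * f y‖ₑ ≤
      eLpNorm (fun y => Ω (x - y)) s (volume.restrict (ball x R)) *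
        eLpNorm f (ENNReal.ofReal (conjExp s)) (volume.restrict (ball x R)) := by
  have := holderConjugate_conjExp hs
  have hΩx : Measurable fun y => Ω (x - y) := by fun_prop
  have h := eLpNorm_smul_le_mul_eLpNorm (p := s) (q := ENNReal.ofReal (conjExp s)) (r := 1)
    (μ := volume.restrict (ball x R)) hf.aestronglyMeasurable hΩx.aestronglyMeasurable
  rw [eLpNorm_one_eq_lintegral_enorm] at h
  simpa only [Pi.smul_apply', smul_eq_mul] using h

theorem volume_ball_rpow {n : ℕ} (x : Euc n) {R : ℝ} (hR : 0 < R) (e : ℝ) :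
    volume (ball x R) ^ e = ENNReal.ofReal (R ^ (n * e)) * volume (ball (0 : Euc n) 1) ^ e := by
  rw [Measure.addHaar_ball_of_pos _ _ hR, ENNReal.mul_rpow_of_ne_top ENNReal.ofReal_ne_top
    measure_ball_lt_top.ne, ENNReal.ofReal_rpow_of_pos (by positivity), finrank_euclideanSpace,
    Fintype.card_fin, Real.rpow_mul hR.le, Real.rpow_natCast]

theorem prod_lintegral_ball_le {n m : ℕ} {s : ℝ≥0∞} (hs : 1 < s) {Ω f : Fin m → Euc n → ℝ}
    (hΩ : ∀ i, Measurable (Ω i)) (hf : ∀ i, Measurable (f i)) {x : Euc n} {R : ℝ}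
    {K : Fin m → ℝ≥0∞}
    (hK : ∀ i, eLpNorm (fun y => Ω i (x - y)) s (volume.restrict (ball x R)) ≤
      K i * volume (ball x R) ^ (1 / s.toReal)) :
    ∏ i, ∫⁻ y in ball x R, ‖Ω i (x - y) * f i y‖ₑ ≤
      (∏ i, K i) * volume (ball x R) ^ (m / s.toReal) *
        ∏ i, eLpNorm (f i) (ENNReal.ofReal (conjExp s)) (volume.restrict (ball x R)) := by
  have : volume (ball x R) ^ (m / s.toReal) =
      ∏ _i : Fin m, volume (ball x R) ^ (1 / s.toReal) := by
    rw [Finset.prod_const, Finset.card_univ, Fintype.card_fin, ← ENNReal.rpow_mul_natCast]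
    congr 1
    ring
  rw [this, ← Finset.prod_mul_distrib, ← Finset.prod_mul_distrib]
  refine Finset.prod_le_prod' fun i _ => ?_
  refine (lintegral_ball_enorm_mul_le hs (hΩ i) (hf i) x R).trans ?_
  gcongr
  exact hK i

theorem prod_eLpNorm_ball_le_prod_morreyNorm {n m : ℕ} {t κ P : ℝ} {p : Fin m → ℝ} (ht : 0 < t)
    (htp : ∀ i, t ≤ p i) (hP : 1 / P = ∑ i, 1 / p i) {f : Fin m → Euc n → ℝ}
    (hf : ∀ i, Measurable (f i)) (x : Euc n) {R : ℝ} (hR : 0 < R) :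
    ∏ i, eLpNorm (f i) (ENNReal.ofReal t) (volume.restrict (ball x R)) ≤
      volume (ball x R) ^ ((κ - 1) / P + m / t) * ∏ i, morreyNorm (p i) κ (f i) := by
  have hV0 : volume (ball x R) ≠ 0 := (measure_ball_pos _ _ hR).ne'
  have hVt : volume (ball x R) ≠ ⊤ := measure_ball_lt_top.ne
  have hsum : (κ - 1) / P + m / t = ∑ i, ((κ - 1) / p i + 1 / t) := by
    rw [Finset.sum_add_distrib, Finset.sum_const, Finset.card_univ, Fintype.card_fin,
      nsmul_eq_mul, mul_one_div, div_eq_mul_one_div, hP, Finset.mul_sum]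
    simp_rw [mul_one_div]
  have hpow : volume (ball x R) ^ ((κ - 1) / P + m / t) =
      ∏ i, volume (ball x R) ^ ((κ - 1) / p i + 1 / t) := by
    rw [hsum]
    induction (Finset.univ : Finset (Fin m)) using Finset.induction_on with
    | empty => simp
    | insert a S ha ih =>
      rw [Finset.sum_insert ha, Finset.prod_insert ha, ENNReal.rpow_add _ _ hV0 hVt, ih]
  rw [hpow, ← Finset.prod_mul_distrib]
  exact Finset.prod_le_prod' fun i _ => eLpNorm_ball_le_morreyNorm ht (htp i) (hf i) x hR

/-- Adams-type pointwise estimate for the multilinear fractional integral operator with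
homogeneous kernels, in terms of Morrey norms. -/
theorem stmt12
    (n m : ℕ) (hn : 2 ≤ n) (hm : 1 ≤ m) (α : ℝ) (hα : 0 < α) (hαmn : α < m * n)
    (s : ℝ≥0∞) (hs : 1 < s) (Ω : Fin m → Euc n → ℝ) (hΩ : ∀ i, MemSphereLp n s (Ω i))
    (p : Fin m → ℝ) (P q κ : ℝ)
    (hpi : ∀ i, conjExp s ≤ p i)
    (hP : 1 / P = ∑ i, 1 / p i)
    (hPlow : conjExp s / m ≤ P) (hPhigh : P < n / α)
    (hκ0 : 0 < κ) (hκ1 : κ < 1 - α * P / n)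
    (hq : 1 / q = 1 / P - α / (n * (1 - κ))) :
    ∃ C : ℝ, 0 < C ∧ ∀ f : Fin m → Euc n → ℝ,
      (∀ i, Measurable (f i)) → (∀ i, morreyNorm (p i) κ (f i) < ⊤) →
      ∀ x : Euc n,
        ENNReal.ofReal |multiT m α Ω f x| ≤
          ENNReal.ofReal C * multiMt m (conjExp s) f x ^ (P / q) *
            (∏ i, morreyNorm (p i) κ (f i)) ^ (1 - P / q) := by
  have hn0 : 0 < n := by lia
  have hnR : (0 : ℝ) < n := by exact_mod_cast hn0
  have hmR : (0 : ℝ) < m := by exact_mod_cast hm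
  set t := conjExp s with ht_def
  have ht : 0 < t := zero_lt_one.trans_le (one_le_conjExp hs)
  have hst : 1 / s.toReal + 1 / t = 1 := one_div_add_one_div_conjExp hs
  have hP0 : 0 < P := (div_pos ht hmR).trans_le hPlow
  have hακ : α * P < n * (1 - κ) := by
    have := (div_lt_iff₀ hnR).1 (show α * P / n < 1 - κ by linarith)
    linarith
  have hκ : 0 < 1 - κ := pos_of_mul_pos_right ((mul_pos hα hP0).trans hακ) hnR.le
  set β : ℝ := n * (1 - κ) / P with hβ
  have hαβ : α < β := (lt_div_iff₀ hP0).2 hακ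
  have hPq : P / q = 1 - α / β := by
    rw [div_eq_mul_one_div, hq, hβ]
    field_simp
  set v : ℝ≥0∞ := volume (ball (0 : Euc n) 1) with hv
  have hv0 : v ≠ 0 := (measure_ball_pos _ _ one_pos).ne'
  have hvt : v ≠ ⊤ := measure_ball_lt_top.ne
  set e : ℝ := m + (κ - 1) / P with he
  choose K hK hKle using fun i => (hΩ i).exists_eLpNorm_ball_le hn0
  set L : ℝ≥0∞ := (∏ i, K i) * (v ^ (m : ℝ) + v ^ e) with hL
  have hLt : L ≠ ⊤ := ENNReal.mul_ne_top (ENNReal.prod_ne_top fun i _ => hK i)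
    (ENNReal.add_ne_top.2 ⟨ENNReal.rpow_ne_top_of_ne_zero hv0 hvt,
      ENNReal.rpow_ne_top_of_ne_zero hv0 hvt⟩)
  set D : ℝ≥0∞ := ENNReal.ofReal (m * n - α) *
    (1 + L * ENNReal.ofReal (1 / α + 1 / (β - α))) with hD
  have hDt : D ≠ ⊤ := ENNReal.mul_ne_top ENNReal.ofReal_ne_top
    (ENNReal.add_ne_top.2 ⟨ENNReal.one_ne_top, ENNReal.mul_ne_top hLt ENNReal.ofReal_ne_top⟩)
  have hD0 : D ≠ 0 := mul_ne_zero (by simpa using hαmn) (by simp)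
  refine ⟨D.toReal, ENNReal.toReal_pos hD0 hDt, fun f hf hfM x => ?_⟩
  rw [ENNReal.ofReal_toReal hDt, hPq, _root_.sub_sub_cancel]
  refine (ofReal_abs_multiT_le hαmn (fun i => (hΩ i).1) hf x).trans ?_
  rw [hD, mul_assoc, mul_assoc, ← mul_assoc (1 + _)]
  gcongr
  have hms : m / s.toReal + m / t = m := by
    rw [div_eq_mul_one_div, div_eq_mul_one_div (m : ℝ) t, ← mul_add, hst, mul_one]
  refine lintegral_Ioi_le_of_le_rpow hα hαβ hLt (ENNReal.prod_lt_top fun i _ => hfM i).ne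
    (fun R hR => ?_) fun R hR => ?_
  all_goals
    have hV0 : volume (ball x R) ≠ 0 := (measure_ball_pos _ _ hR).ne'
    have hVt : volume (ball x R) ≠ ⊤ := measure_ball_lt_top.ne
  · calc _ ≤ ENNReal.ofReal (R ^ (-(m * n - α) - 1)) *
          ((∏ i, K i) * volume (ball x R) ^ (m / s.toReal) *
            (volume (ball x R) ^ (m / t) * multiMt m t f x)) := by
          gcongr
          refine (prod_lintegral_ball_le hs (fun i => (hΩ i).1) hf fun i => hKle i x R hR).trans ?_
          gcongr
          exact prod_eLpNorm_ball_le_multiMt ht f x hR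
      _ = ENNReal.ofReal (R ^ (-(m * n - α) - 1)) *
          ((∏ i, K i) * volume (ball x R) ^ (m : ℝ) * multiMt m t f x) := by
          have : volume (ball x R) ^ (m : ℝ) =
              volume (ball x R) ^ (m / s.toReal) * volume (ball x R) ^ (m / t) := by
            rw [← ENNReal.rpow_add _ _ hV0 hVt, hms]
          rw [this]
          ring
      _ = (∏ i, K i) * v ^ (m : ℝ) * ENNReal.ofReal (R ^ (α - 1)) * multiMt m t f x := by
          have : R ^ (α - 1) = R ^ (-(m * n - α) - 1) * R ^ (n * m : ℝ) := by
            rw [← Real.rpow_add hR]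
            congr 1
            ring
          rw [volume_ball_rpow x hR, this, ENNReal.ofReal_mul (by positivity)]
          ring
      _ ≤ _ := by
          rw [hL]
          gcongr
          exact le_self_add
  · calc _ ≤ ENNReal.ofReal (R ^ (-(m * n - α) - 1)) *
          ((∏ i, K i) * volume (ball x R) ^ (m / s.toReal) *
            (volume (ball x R) ^ ((κ - 1) / P + m / t) * ∏ i, morreyNorm (p i) κ (f i))) := by
          gcongr
          refine (prod_lintegral_ball_le hs (fun i => (hΩ i).1) hf fun i => hKle i x R hR).trans ?_
          gcongr
          exact prod_eLpNorm_ball_le_prod_morreyNorm ht hpi hP hf x hR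
      _ = ENNReal.ofReal (R ^ (-(m * n - α) - 1)) *
          ((∏ i, K i) * volume (ball x R) ^ e * ∏ i, morreyNorm (p i) κ (f i)) := by
          have : e = m / s.toReal + ((κ - 1) / P + m / t) := by linarith
          rw [this, ENNReal.rpow_add (m / s.toReal) _ hV0 hVt]
          ring
      _ = (∏ i, K i) * v ^ e * ENNReal.ofReal (R ^ (-(β - α) - 1)) *
          ∏ i, morreyNorm (p i) κ (f i) := by
          have : R ^ (-(β - α) - 1) = R ^ (-(m * n - α) - 1) * R ^ (n * e) := by
            rw [← Real.rpow_add hR]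
            congr 1
            rw [he, hβ]
            ring
          rw [volume_ball_rpow x hR, this, ENNReal.ofReal_mul (by positivity)]
          ring
      _ ≤ _ := by
          rw [hL]
          gcongr
          exact le_add_self

end
end

section
/- Let n ≥ 1, 1 ≤ q < p < ∞, and set κ = 1 − q/p. Then for every measurable function f on ℝⁿ, ‖f‖_{L^{q,κ}} ≤ (p/(p−q))^{1/q} ‖f‖_{L^{p,∞}}; in particular the weak Lebesgue space L^{p,∞}(ℝⁿ) embeds into the Morrey space L^{q,κ}(ℝⁿ). -/
open MeasureTheory Metric ENNReal

noncomputable section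

/-- Distribution function estimate: on a measure space of total mass at most `v`, a function with
weak `L^p` norm at most `a` satisfies `∫ g^q ≤ p / (p - q) * a^q * v^(1 - q/p)`. -/
lemma lintegral_rpow_le_of_meas_lt_le {α : Type*} [MeasurableSpace α] {μ : Measure α} {g : α → ℝ}
    (hg0 : ∀ x, 0 ≤ g x) (hg : AEMeasurable g μ) {p q a v : ℝ} (hq : 0 < q) (hqp : q < p)
    (ha : 0 < a) (hv : 0 < v) (hμ : μ Set.univ ≤ ENNReal.ofReal v)
    (h : ∀ t, 0 < t → μ {x | t < g x} ≤ ENNReal.ofReal ((a / t) ^ p)) :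
    ∫⁻ x, ENNReal.ofReal (g x ^ q) ∂μ ≤
      ENNReal.ofReal (p / (p - q) * a ^ q * v ^ (1 - q / p)) := by
  have hp : 0 < p := hq.trans hqp
  have hpq : 0 < p - q := sub_pos.2 hqp
  set c : ℝ := a * v ^ (-(1 / p)) with hc_def
  have hc : 0 < c := by positivity
  rw [lintegral_rpow_eq_lintegral_meas_lt_mul μ (Filter.Eventually.of_forall hg0) hg hq,
    ← Set.Ioc_union_Ioi_eq_Ioi hc.le,
    lintegral_union measurableSet_Ioi (Set.Ioc_disjoint_Ioi le_rfl)]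
  have hsmall : ∫⁻ t in Set.Ioc 0 c, μ {x | t < g x} * ENNReal.ofReal (t ^ (q - 1)) ≤
      ENNReal.ofReal (v * (c ^ q / q)) := by
    have hint : IntegrableOn (fun t : ℝ => v * t ^ (q - 1)) (Set.Ioc 0 c) :=
      ((intervalIntegrable_iff_integrableOn_Ioc_of_le hc.le).1
        (intervalIntegral.intervalIntegrable_rpow' (by linarith))).const_mul v
    calc _ ≤ ∫⁻ t in Set.Ioc 0 c, ENNReal.ofReal (v * t ^ (q - 1)) := by
          refine setLIntegral_mono' measurableSet_Ioc fun t _ => ?_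
          rw [ENNReal.ofReal_mul hv.le]
          gcongr
          exact (measure_mono (Set.subset_univ _)).trans hμ
      _ = ENNReal.ofReal (∫ t in Set.Ioc 0 c, v * t ^ (q - 1)) := by
          refine (ofReal_integral_eq_lintegral_ofReal hint ?_).symm
          filter_upwards [ae_restrict_mem measurableSet_Ioc] with t ht
          have : 0 < t := ht.1
          positivity
      _ = ENNReal.ofReal (v * (c ^ q / q)) := by
          rw [integral_const_mul, ← intervalIntegral.integral_of_le hc.le,
            integral_rpow (Or.inl (by linarith)), sub_add_cancel, Real.zero_rpow hq.ne', sub_zero]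
  have hlarge : ∫⁻ t in Set.Ioi c, μ {x | t < g x} * ENNReal.ofReal (t ^ (q - 1)) ≤
      ENNReal.ofReal (a ^ p * (c ^ (q - p) / (p - q))) := by
    have hexp : q - 1 - p < -1 := by linarith
    calc _ ≤ ∫⁻ t in Set.Ioi c, ENNReal.ofReal (a ^ p * t ^ (q - 1 - p)) := by
          refine setLIntegral_mono' measurableSet_Ioi fun t ht => ?_
          have ht0 : 0 < t := hc.trans ht
          refine (mul_le_mul_left (h t ht0) _).trans_eq ?_
          rw [← ENNReal.ofReal_mul (by positivity), Real.div_rpow ha.le ht0.le,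
            Real.rpow_sub ht0 (q - 1) p]
          congr 1
          ring
      _ = ENNReal.ofReal (∫ t in Set.Ioi c, a ^ p * t ^ (q - 1 - p)) := by
          refine (ofReal_integral_eq_lintegral_ofReal
            ((integrableOn_Ioi_rpow_of_lt hexp hc).const_mul _) ?_).symm
          filter_upwards [ae_restrict_mem measurableSet_Ioi] with t ht
          have : 0 < t := hc.trans ht
          positivity
      _ = ENNReal.ofReal (a ^ p * (c ^ (q - p) / (p - q))) := by
          rw [integral_const_mul, integral_Ioi_rpow_of_lt hexp hc,
            show q - 1 - p + 1 = q - p by ring, ← neg_sub p q, neg_div_neg_eq]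
  refine (mul_le_mul_right (add_le_add hsmall hlarge) _).trans_eq ?_
  rw [← ENNReal.ofReal_add (by positivity) (by positivity), ← ENNReal.ofReal_mul hq.le]
  congr 1
  have hcq : v * c ^ q = a ^ q * v ^ (1 - q / p) := by
    rw [hc_def, Real.mul_rpow ha.le (by positivity), ← Real.rpow_mul hv.le,
      show 1 - q / p = 1 + -(1 / p) * q by ring, Real.rpow_add hv, Real.rpow_one]
    ring
  have hcp : a ^ p * c ^ (q - p) = a ^ q * v ^ (1 - q / p) := by
    rw [hc_def, Real.mul_rpow ha.le (by positivity), ← Real.rpow_mul hv.le, ← mul_assoc,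
      ← Real.rpow_add ha, add_sub_cancel]
    congr 2
    field_simp
    ring
  rw [← mul_div_assoc, ← mul_div_assoc, hcq, hcp]
  field_simp
  ring

/-- The Morrey norm of a function whose weak `L^p` norm is at most a positive real `a`. -/
lemma morreyNorm_le_of_weakLpNorm_le {n : ℕ} {p q a : ℝ} (hq : 0 < q) (hqp : q < p) (ha : 0 < a)
    {f : Euc n → ℝ} (hf : Measurable f) (h : weakLpNorm p f ≤ ENNReal.ofReal a) :
    morreyNorm q (1 - q / p) f ≤
      ENNReal.ofReal ((p / (p - q)) ^ (1 / q)) * ENNReal.ofReal a := by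
  have hp : 0 < p := hq.trans hqp
  have hpq : 0 < p - q := sub_pos.2 hqp
  have hdist (t : ℝ) (ht : 0 < t) :
      volume {x | t < |f x|} ≤ ENNReal.ofReal ((a / t) ^ p) := by
    have ht' : ENNReal.ofReal t * volume {x | t < |f x|} ^ (1 / p) ≤ ENNReal.ofReal a :=
      (le_iSup (fun l : Set.Ioi (0 : ℝ) =>
        ENNReal.ofReal (l : ℝ) * volume {x | (l : ℝ) < |f x|} ^ (1 / p)) ⟨t, ht⟩).trans h
    rw [← ENNReal.ofReal_rpow_of_pos (by positivity), ENNReal.ofReal_div_of_pos ht,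
      ← ENNReal.rpow_inv_le_iff hp, ← one_div]
    rw [mul_comm] at ht'
    exact (ENNReal.le_div_iff_mul_le (Or.inl (by simpa using ht)) (Or.inl ofReal_ne_top)).2 ht'
  refine iSup_le fun z => iSup_le fun r => ?_
  have hr : 0 < (r : ℝ) := r.2
  set V : ℝ := (volume (ball z (r : ℝ))).toReal
  have hVB : volume (ball z (r : ℝ)) = ENNReal.ofReal V :=
    (ENNReal.ofReal_toReal measure_ball_lt_top.ne).symm
  have hV : 0 < V := ENNReal.toReal_pos (measure_ball_pos _ _ hr).ne' measure_ball_lt_top.ne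
  have key := lintegral_rpow_le_of_meas_lt_le (μ := volume.restrict (ball z (r : ℝ)))
    (g := fun x => |f x|) (fun x => abs_nonneg _) hf.abs.aemeasurable hq hqp ha hV
    (by rw [Measure.restrict_apply_univ, hVB])
    (fun t ht => (Measure.restrict_apply_le _ _).trans (hdist t ht))
  simp_rw [ENNReal.ofReal_rpow_of_nonneg (abs_nonneg _) hq.le]
  calc _ ≤ (volume (ball z (r : ℝ)) ^ (-(1 - q / p)) *
        ENNReal.ofReal (p / (p - q) * a ^ q * V ^ (1 - q / p))) ^ (1 / q) := by gcongr
    _ = _ := by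
      rw [hVB, ENNReal.ofReal_rpow_of_pos hV, ← ENNReal.ofReal_mul (by positivity),
        ENNReal.ofReal_rpow_of_nonneg (by positivity) (by positivity),
        ← ENNReal.ofReal_mul (by positivity), Real.rpow_neg hV.le,
        show (V ^ (1 - q / p))⁻¹ * (p / (p - q) * a ^ q * V ^ (1 - q / p)) =
          p / (p - q) * a ^ q by field_simp,
        Real.mul_rpow (by positivity) (by positivity), one_div, Real.rpow_rpow_inv ha.le hq.ne']

/-- The weak Lebesgue space `L^{p,∞}` embeds into the Morrey space `L^{q,κ}` with
`κ = 1 - q/p`, with constant `(p/(p-q))^{1/q}`. -/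
theorem stmt15
    (n : ℕ) (hn : 1 ≤ n) (p q : ℝ) (hq : 1 ≤ q) (hqp : q < p)
    (f : Euc n → ℝ) (hf : Measurable f) :
    morreyNorm q (1 - q / p) f ≤
      ENNReal.ofReal ((p / (p - q)) ^ (1 / q)) * weakLpNorm p f := by
  have hq0 : 0 < q := by linarith
  have hC : 0 < (p / (p - q)) ^ (1 / q) :=
    Real.rpow_pos_of_pos (div_pos (hq0.trans hqp) (sub_pos.2 hqp)) _
  refine ENNReal.le_mul_of_forall_lt (Or.inl (by simpa using hC)) (Or.inl ofReal_ne_top)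
    fun c hc b hb => ?_
  refine le_trans ?_ (mul_le_mul_left hc.le b)
  rcases eq_or_ne b ⊤ with rfl | hb_top
  · rw [ENNReal.mul_top (by simpa using hC)]
    exact le_top
  · rw [← ENNReal.ofReal_toReal hb_top] at hb ⊢
    exact morreyNorm_le_of_weakLpNorm_le hq0 hqp
      (ENNReal.ofReal_pos.1 (pos_of_gt hb)) hf hb.le

end
end
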